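/- arXiv:2408.16765 — 2 statements merged into one kernel-verified Lean document; each statement's English description precedes it below -/
import Mathlib

section
/- Suppose E[‖X₀‖₂²] < ∞. Then for every δ ∈ (0,1) and every x₀ ∈ ℝ^d, E[log ρ_δ(X_δ) | X₀ = x₀] = −(1 + log(2π)) d / 2 − ∫_δ¹ D(t, x₀) dt, where D(t, x) := (1/(2(1−t))) · E[ ‖(X_t − √(1−t) X₀)/t + ∇log ρ_t(X_t)‖₂² | X₀ = x ] − d/(2t). -/
open MeasureTheory Real Filter
open scoped ENNReal

noncomputable section

/-- Density at `x` of the Gaussian distribution `N(√(1-t)·x₀, t·I_d)`, i.e. the transition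
density of `X_t = √(1-t)·X₀ + √t·Z` given `X₀ = x₀`. -/
def heatKernel (d : ℕ) (t : ℝ) (x x₀ : EuclideanSpace ℝ (Fin d)) : ℝ :=
  (2 * π * t) ^ (-(d : ℝ) / 2) * Real.exp (-‖x - Real.sqrt (1 - t) • x₀‖ ^ 2 / (2 * t))

/-- The density `ρ_t` of `X_t = √(1-t)·X₀ + √t·Z` where `X₀ ∼ μ` and `Z ∼ N(0, I_d)`
is independent of `X₀`. -/
def rho (d : ℕ) (μ : Measure (EuclideanSpace ℝ (Fin d))) (t : ℝ)
    (x : EuclideanSpace ℝ (Fin d)) : ℝ :=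
  ∫ x₀, heatKernel d t x x₀ ∂μ

/-- Density of the standard Gaussian `N(0, I_d)` on `ℝ^d`. -/
def stdGaussianDensity (d : ℕ) (z : EuclideanSpace ℝ (Fin d)) : ℝ :=
  (2 * π) ^ (-(d : ℝ) / 2) * Real.exp (-‖z‖ ^ 2 / 2)

/-- Conditional expectation `E[f(X_t) | X₀ = x₀] = E_{Z ∼ N(0,I_d)}[f(√(1-t)·x₀ + √t·Z)]`. -/
def condExpX0 (d : ℕ) (t : ℝ) (x₀ : EuclideanSpace ℝ (Fin d))
    (f : EuclideanSpace ℝ (Fin d) → ℝ) : ℝ :=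
  ∫ z, f (Real.sqrt (1 - t) • x₀ + Real.sqrt t • z) * stdGaussianDensity d z

/-- The integrand `D(t, x) := (1/(2(1−t))) · E[‖(X_t − √(1−t)X₀)/t + ∇log ρ_t(X_t)‖² | X₀ = x]
− d/(2t)` appearing in the score-based density formula. -/
def scoreIntegrand (d : ℕ) (μ : Measure (EuclideanSpace ℝ (Fin d))) (t : ℝ)
    (x : EuclideanSpace ℝ (Fin d)) : ℝ :=
  (1 / (2 * (1 - t))) *
      condExpX0 d t x (fun xt =>
        ‖t⁻¹ • (xt - Real.sqrt (1 - t) • x)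
            + gradient (fun y => Real.log (rho d μ t y)) xt‖ ^ 2)
    - d / (2 * t)


namespace ScoreAux

variable {d : ℕ}

local notation "𝔼" => EuclideanSpace ℝ (Fin d)

/-- Unnormalised Gaussian kernel. -/
def K (s : ℝ) (z w : EuclideanSpace ℝ (Fin d)) : ℝ := Real.exp (-(‖z - s • w‖ ^ 2 / 2))

/-- Weighted integral of the kernel. -/
def Q (ν : Measure (EuclideanSpace ℝ (Fin d))) (s : ℝ) (c : EuclideanSpace ℝ (Fin d) → ℝ)
    (z : EuclideanSpace ℝ (Fin d)) : ℝ := ∫ w, c w * K s z w ∂ν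

/-- Normalisation. -/
def P (ν : Measure (EuclideanSpace ℝ (Fin d))) (s : ℝ) (z : EuclideanSpace ℝ (Fin d)) : ℝ :=
  Q ν s (fun _ => 1) z

lemma K_pos (s : ℝ) (z w : 𝔼) : 0 < K s z w := Real.exp_pos _

lemma K_le_one (s : ℝ) (z w : 𝔼) : K s z w ≤ 1 := by
  unfold K
  rw [Real.exp_le_one_iff]
  have := sq_nonneg ‖z - s • w‖
  linarith

lemma norm_mul_K_le (s : ℝ) (z w : 𝔼) : ‖z - s • w‖ * K s z w ≤ 1 := by
  unfold K
  rw [Real.exp_neg, ← div_eq_mul_inv, div_le_one (Real.exp_pos _)]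
  have := Real.add_one_le_exp (‖z - s • w‖ ^ 2 / 2)
  nlinarith [sq_nonneg (‖z - s • w‖ - 1)]

lemma continuous_K (s : ℝ) (z : 𝔼) : Continuous (K s z) := by
  unfold K; fun_prop

lemma integrable_mul_K {ν : Measure 𝔼} (s : ℝ) (z : 𝔼) {c : 𝔼 → ℝ} (hc : Integrable c ν) :
    Integrable (fun w => c w * K s z w) ν := by
  refine hc.mono (hc.aestronglyMeasurable.mul (continuous_K s z).aestronglyMeasurable) ?_
  filter_upwards with w
  rw [norm_mul]
  have := K_le_one s z w
  rw [Real.norm_of_nonneg (K_pos s z w).le]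
  exact mul_le_of_le_one_right (norm_nonneg _) this

lemma hasFDerivAt_K (s : ℝ) (z w : 𝔼) :
    HasFDerivAt (fun z => K s z w) ((-(K s z w)) • innerSL ℝ (z - s • w)) z := by
  have h1 : HasFDerivAt (fun z : 𝔼 => z - s • w) (ContinuousLinearMap.id ℝ 𝔼) z :=
    (hasFDerivAt_id z).sub_const _
  have h2 := ((h1.norm_sq.const_mul (1 / 2 : ℝ)).neg).exp
  unfold K
  convert! h2 using 1
  · ext y; congr 2; ring
  · ext v
    have : (‖z - s • w‖ ^ 2 / 2) = 1 / 2 * ‖z - s • w‖ ^ 2 := by ring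
    rw [this]
    simp

lemma hasFDerivAt_Q {ν : Measure 𝔼} (s : ℝ) {c : 𝔼 → ℝ} (hc : Integrable c ν) (z : 𝔼) :
    HasFDerivAt (Q ν s c) (∫ w, (-(c w * K s z w)) • innerSL ℝ (z - s • w) ∂ν) z := by
  have := hasFDerivAt_integral_of_dominated_of_fderiv_le (μ := ν) (𝕜 := ℝ) (s := Set.univ)
    (F := fun z w => c w * K s z w) (x₀ := z)
    (F' := fun z w => (-(c w * K s z w)) • innerSL ℝ (z - s • w)) (bound := fun w => ‖c w‖)
    Filter.univ_mem
    (Filter.Eventually.of_forall fun z => (integrable_mul_K s z hc).aestronglyMeasurable)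
    (integrable_mul_K s z hc) ?_ ?_ hc.norm ?_
  · exact this
  · refine (integrable_mul_K s z hc).aestronglyMeasurable.neg.smul ?_
    refine Continuous.aestronglyMeasurable ?_
    fun_prop
  · filter_upwards with w z _
    rw [norm_smul, innerSL_apply_norm, norm_neg, norm_mul, Real.norm_of_nonneg (K_pos s z w).le]
    have := norm_mul_K_le s z w
    nlinarith [norm_nonneg (c w)]
  · filter_upwards with w z _
    have := (hasFDerivAt_K s z w).const_mul (c w)
    convert! this using 1
    rw [smul_smul]; congr 1; ring

lemma Q_fderiv_integrable {ν : Measure 𝔼} (s : ℝ) {c : 𝔼 → ℝ} (hc : Integrable c ν) (z : 𝔼) :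
    Integrable (fun w => (-(c w * K s z w)) • innerSL ℝ (z - s • w)) ν := by
  refine hc.norm.mono' ((integrable_mul_K s z hc).aestronglyMeasurable.neg.smul
    (Continuous.aestronglyMeasurable (by fun_prop))) ?_
  filter_upwards with w
  rw [norm_smul, innerSL_apply_norm, norm_neg, norm_mul, Real.norm_of_nonneg (K_pos s z w).le]
  have := norm_mul_K_le s z w
  nlinarith [norm_nonneg (c w)]

lemma Q_fderiv_apply {ν : Measure 𝔼} (s : ℝ) {c : 𝔼 → ℝ} (hc : Integrable c ν) (z : 𝔼)
    (i : Fin d) :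
    (∫ w, (-(c w * K s z w)) • innerSL ℝ (z - s • w) ∂ν) (EuclideanSpace.single i 1)
      = -Q ν s (fun w => c w * (z i - s * w i)) z := by
  rw [ContinuousLinearMap.integral_apply (Q_fderiv_integrable s hc z)]
  unfold Q
  rw [← integral_neg]
  congr 1
  ext w
  simp [EuclideanSpace.inner_single_right]
  ring

lemma continuous_Q {ν : Measure 𝔼} (s : ℝ) {c : 𝔼 → ℝ} (hc : Integrable c ν) :
    Continuous (Q ν s c) :=
  continuous_iff_continuousAt.2 fun z => (hasFDerivAt_Q s hc z).continuousAt

lemma Q_add {ν : Measure 𝔼} (s : ℝ) {c c' : 𝔼 → ℝ} (hc : Integrable c ν) (hc' : Integrable c' ν)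
    (z : 𝔼) : Q ν s (fun w => c w + c' w) z = Q ν s c z + Q ν s c' z := by
  unfold Q
  rw [← integral_add (integrable_mul_K s z hc) (integrable_mul_K s z hc')]
  congr 1; ext w; ring

lemma Q_sub {ν : Measure 𝔼} (s : ℝ) {c c' : 𝔼 → ℝ} (hc : Integrable c ν) (hc' : Integrable c' ν)
    (z : 𝔼) : Q ν s (fun w => c w - c' w) z = Q ν s c z - Q ν s c' z := by
  unfold Q
  rw [← integral_sub (integrable_mul_K s z hc) (integrable_mul_K s z hc')]
  congr 1; ext w; ring

lemma Q_smul {ν : Measure 𝔼} (s a : ℝ) (c : 𝔼 → ℝ) 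
    (z : 𝔼) : Q ν s (fun w => a * c w) z = a * Q ν s c z := by
  unfold Q
  rw [← integral_const_mul]
  congr 1; ext w; ring

lemma Q_mono {ν : Measure 𝔼} (s : ℝ) {c c' : 𝔼 → ℝ} (hc : Integrable c ν) (hc' : Integrable c' ν)
    (z : 𝔼) (h : ∀ w, c w ≤ c' w) : Q ν s c z ≤ Q ν s c' z := 
  integral_mono (integrable_mul_K s z hc) (integrable_mul_K s z hc')
    fun w => mul_le_mul_of_nonneg_right (h w) (K_pos s z w).le

section
variable {ν : Measure (EuclideanSpace ℝ (Fin d))} [IsProbabilityMeasure ν]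

lemma P_le_one (s : ℝ) (z : 𝔼) : P ν s z ≤ 1 := by
  have : P ν s z ≤ ∫ w : 𝔼, (1 : ℝ) ∂ν :=
    integral_mono (integrable_mul_K s z (integrable_const 1)) (integrable_const 1)
      fun w => by simpa using K_le_one s z w
  simpa using this

lemma P_const (s a : ℝ) (z : 𝔼) : Q ν s (fun _ => a) z = a * P ν s z := by
  unfold P; rw [← Q_smul]; simp

lemma norm_integrable (hν : Integrable (fun w : 𝔼 => ‖w‖ ^ 2) ν) :
    Integrable (fun w : 𝔼 => ‖w‖) ν := by
  refine ((integrable_const (1 : ℝ)).add hν).mono' (by fun_prop) ?_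
  filter_upwards with w
  simp
  nlinarith [sq_nonneg (‖w‖ - 1)]

lemma of_bound (hν : Integrable (fun w : 𝔼 => ‖w‖ ^ 2) ν) {c : 𝔼 → ℝ} (hc : Continuous c)
    {α β : ℝ} (h : ∀ w, |c w| ≤ α + β * ‖w‖ ^ 2) : Integrable c ν :=
  ((integrable_const α).add (hν.const_mul β)).mono' hc.aestronglyMeasurable
    (Filter.Eventually.of_forall h)

lemma u_le (s : ℝ) (z w : 𝔼) : ‖z - s • w‖ ^ 2 / 2 ≤ ‖z‖ ^ 2 + s ^ 2 * ‖w‖ ^ 2 := by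
  have h1 := norm_sub_le z (s • w)
  have h2 : ‖s • w‖ ^ 2 = s ^ 2 * ‖w‖ ^ 2 := by rw [norm_smul, mul_pow]; simp
  rw [← h2]
  nlinarith [sq_nonneg (‖z‖ - ‖s • w‖), norm_nonneg (z - s • w)]

lemma u_ge (s : ℝ) (z w : 𝔼) : s ^ 2 * ‖w‖ ^ 2 ≤ 4 * (‖z - s • w‖ ^ 2 / 2) + 2 * ‖z‖ ^ 2 := by
  have h1 := norm_sub_le z (z - s • w)
  have h2 : ‖s • w‖ ^ 2 = s ^ 2 * ‖w‖ ^ 2 := by rw [norm_smul, mul_pow]; simp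
  rw [← h2]
  simp only [sub_sub_cancel] at h1
  nlinarith [sq_nonneg (‖z‖ - ‖z - s • w‖), norm_nonneg (s • w)]


lemma u_int (hν : Integrable (fun w : 𝔼 => ‖w‖ ^ 2) ν)
    (s : ℝ) (z : 𝔼) : Integrable (fun w : 𝔼 => ‖z - s • w‖ ^ 2 / 2) ν := by
  refine of_bound hν (by fun_prop) (α := ‖z‖ ^ 2) (β := s ^ 2) fun w => ?_
  rw [abs_of_nonneg (by positivity)]
  exact u_le s z w

lemma ubar_le (hν : Integrable (fun w : 𝔼 => ‖w‖ ^ 2) ν)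
    (s : ℝ) (z : 𝔼) :
    ∫ w, ‖z - s • w‖ ^ 2 / 2 ∂ν ≤ ‖z‖ ^ 2 + s ^ 2 * ∫ w, ‖w‖ ^ 2 ∂ν := by
  have := integral_mono (u_int hν s z) ((integrable_const (‖z‖ ^ 2)).add (hν.const_mul (s ^ 2)))
    fun w => u_le s z w
  rw [integral_add' (integrable_const _) (hν.const_mul _)] at this
  simpa [integral_const_mul] using this

lemma P_ge (hν : Integrable (fun w : 𝔼 => ‖w‖ ^ 2) ν)
    (s : ℝ) (z : 𝔼) : Real.exp (-(‖z‖ ^ 2 + s ^ 2 * ∫ w, ‖w‖ ^ 2 ∂ν)) ≤ P ν s z := by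
  set m := ∫ w, ‖z - s • w‖ ^ 2 / 2 ∂ν with hm
  have h0 : Real.exp (-(‖z‖ ^ 2 + s ^ 2 * ∫ w, ‖w‖ ^ 2 ∂ν)) ≤ Real.exp (-m) := by
    rw [Real.exp_le_exp]; linarith [ubar_le hν s z]
  refine h0.trans ?_
  have h1 : ∫ w, (Real.exp (-m) * (1 + m) - Real.exp (-m) * (‖z - s • w‖ ^ 2 / 2)) ∂ν ≤ P ν s z := by
    refine integral_mono ((integrable_const _).sub ((u_int hν s z).const_mul _))
      (integrable_mul_K s z (integrable_const 1)) fun w => ?_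
    simp only [one_mul]
    unfold K
    have h2 := Real.add_one_le_exp (m - ‖z - s • w‖ ^ 2 / 2)
    have h3 : Real.exp (-(‖z - s • w‖ ^ 2 / 2)) = Real.exp (-m) * Real.exp (m - ‖z - s • w‖ ^ 2 / 2) := by
      rw [← Real.exp_add]; congr 1; ring
    rw [h3]
    nlinarith [Real.exp_pos (-m)]
  rw [integral_sub (integrable_const _) ((u_int hν s z).const_mul _), integral_const_mul (Real.exp (-m)) (fun w => ‖z - s • w‖ ^ 2 / 2), ← hm] at h1
  simp at h1
  linarith

lemma P_pos (hν : Integrable (fun w : 𝔼 => ‖w‖ ^ 2) ν)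
    (s : ℝ) (z : 𝔼) : 0 < P ν s z := (Real.exp_pos _).trans_le (P_ge hν s z)

lemma abs_log_P (hν : Integrable (fun w : 𝔼 => ‖w‖ ^ 2) ν)
    (s : ℝ) (z : 𝔼) : |Real.log (P ν s z)| ≤ ‖z‖ ^ 2 + s ^ 2 * ∫ w, ‖w‖ ^ 2 ∂ν := by
  rw [abs_of_nonpos (Real.log_nonpos (P_pos hν s z).le (P_le_one s z))]
  have := (Real.le_log_iff_exp_le (P_pos hν s z)).2 (P_ge hν s z)
  linarith

lemma Q_u_le (hν : Integrable (fun w : 𝔼 => ‖w‖ ^ 2) ν)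
    (s : ℝ) (z : 𝔼) :
    Q ν s (fun w => ‖z - s • w‖ ^ 2 / 2) z ≤ (‖z‖ ^ 2 + s ^ 2 * ∫ w, ‖w‖ ^ 2 ∂ν) * P ν s z := by
  set m := ∫ w, ‖z - s • w‖ ^ 2 / 2 ∂ν with hm
  have h1 : Q ν s (fun w => ‖z - s • w‖ ^ 2 / 2 - m) z ≤
      ∫ w, (‖z - s • w‖ ^ 2 / 2 - m) * Real.exp (-m) ∂ν := by
    refine integral_mono (integrable_mul_K s z ((u_int hν s z).sub (integrable_const _)))
      (((u_int hν s z).sub (integrable_const _)).mul_const _) fun w => ?_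
    simp only
    unfold K
    rcases le_total m (‖z - s • w‖ ^ 2 / 2) with h | h
    · exact mul_le_mul_of_nonneg_left (Real.exp_le_exp.2 (by linarith)) (by linarith)
    · exact mul_le_mul_of_nonpos_left (Real.exp_le_exp.2 (by linarith)) (by linarith)
  rw [integral_mul_const, integral_sub (u_int hν s z) (integrable_const _), ← hm,
    Q_sub s (u_int hν s z) (integrable_const _), P_const] at h1
  simp at h1
  have := ubar_le hν s z
  have := P_pos hν s z
  nlinarith

lemma Q_sq_le (hν : Integrable (fun w : 𝔼 => ‖w‖ ^ 2) ν)
    {s : ℝ} (hs : s ≠ 0) (z : 𝔼) :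
    Q ν s (fun w => ‖w‖ ^ 2) z ≤ (6 * ‖z‖ ^ 2 / s ^ 2 + 4 * ∫ w, ‖w‖ ^ 2 ∂ν) * P ν s z := by
  have h1 : Q ν s (fun w => s ^ 2 * ‖w‖ ^ 2) z ≤
      Q ν s (fun w => 4 * (‖z - s • w‖ ^ 2 / 2) + 2 * ‖z‖ ^ 2) z :=
    Q_mono s (hν.const_mul _) (((u_int hν s z).const_mul 4).add (integrable_const _)) z (u_ge s z)
  rw [Q_smul, Q_add s ((u_int hν s z).const_mul 4) (integrable_const _), Q_smul, P_const] at h1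
  have h2 := Q_u_le hν s z
  have hs2 : 0 < s ^ 2 := by positivity
  rw [← mul_le_mul_iff_right₀ hs2]
  have : s ^ 2 * ((6 * ‖z‖ ^ 2 / s ^ 2 + 4 * ∫ w, ‖w‖ ^ 2 ∂ν) * P ν s z)
    = (6 * ‖z‖ ^ 2 + 4 * s ^ 2 * ∫ w, ‖w‖ ^ 2 ∂ν) * P ν s z := by
      field_simp
  rw [this]
  nlinarith

lemma ratio_bound (hν : Integrable (fun w : 𝔼 => ‖w‖ ^ 2) ν)
    {s : ℝ} (hs : s ≠ 0) (z : 𝔼) {c : 𝔼 → ℝ} {α β : ℝ} (hβ : 0 ≤ β)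
    (h : ∀ w, |c w| ≤ α + β * ‖w‖ ^ 2) :
    |Q ν s c z / P ν s z| ≤ α + β * (6 * ‖z‖ ^ 2 / s ^ 2 + 4 * ∫ w, ‖w‖ ^ 2 ∂ν) := by
  have hP := P_pos hν s z
  rw [abs_div, abs_of_pos hP, div_le_iff₀ hP]
  have h1 : |Q ν s c z| ≤ Q ν s (fun w => α + β * ‖w‖ ^ 2) z := by
    unfold Q
    refine norm_integral_le_of_norm_le (f := fun w => c w * K s z w)
      (integrable_mul_K s z ((integrable_const α).add (hν.const_mul β))) ?_
    filter_upwards with w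
    rw [norm_mul, Real.norm_of_nonneg (K_pos s z w).le]
    exact mul_le_mul_of_nonneg_right (h w) (K_pos s z w).le
  rw [Q_add s (integrable_const α) (hν.const_mul β), P_const, Q_smul] at h1
  have h2 := Q_sq_le hν hs z
  nlinarith

end

/-- Continuous functions of polynomial growth. -/
def PG (f : EuclideanSpace ℝ (Fin d) → ℝ) : Prop :=
  Continuous f ∧ ∃ C : ℝ, 0 ≤ C ∧ ∃ k : ℕ, ∀ z, |f z| ≤ C * (1 + ‖z‖ ^ 2) ^ k

lemma PG.mul {f g : 𝔼 → ℝ} (hf : PG f) (hg : PG g) : PG (fun z => f z * g z) := by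
  obtain ⟨hf, C, hC, k, h⟩ := hf
  obtain ⟨hg, C', hC', k', h'⟩ := hg
  refine ⟨hf.mul hg, C * C', by positivity, k + k', fun z => ?_⟩
  rw [abs_mul, pow_add]
  calc _ ≤ (C * (1 + ‖z‖ ^ 2) ^ k) * (C' * (1 + ‖z‖ ^ 2) ^ k') :=
        mul_le_mul (h z) (h' z) (abs_nonneg _) (by positivity)
    _ = _ := by ring

lemma PG.add {f g : 𝔼 → ℝ} (hf : PG f) (hg : PG g) : PG (fun z => f z + g z) := by
  obtain ⟨hf, C, hC, k, h⟩ := hf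
  obtain ⟨hg, C', hC', k', h'⟩ := hg
  refine ⟨hf.add hg, C + C', by positivity, k + k', fun z => ?_⟩
  have h1 : (1 : ℝ) ≤ 1 + ‖z‖ ^ 2 := by nlinarith [sq_nonneg ‖z‖]
  have h2 : (1 + ‖z‖ ^ 2) ^ k ≤ (1 + ‖z‖ ^ 2) ^ (k + k') := pow_le_pow_right₀ h1 (by omega)
  have h3 : (1 + ‖z‖ ^ 2) ^ k' ≤ (1 + ‖z‖ ^ 2) ^ (k + k') := pow_le_pow_right₀ h1 (by omega)
  have := abs_add_le (f z) (g z)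
  nlinarith [h z, h' z]

lemma PG.const (a : ℝ) : PG (fun _ : 𝔼 => a) :=
  ⟨continuous_const, |a|, abs_nonneg _, 0, fun z => by simp⟩

lemma PG.norm : PG (fun z : 𝔼 => ‖z‖) := by
  refine ⟨continuous_norm, 1, zero_le_one, 1, fun z => ?_⟩
  rw [abs_norm]; nlinarith [sq_nonneg (‖z‖ - 1)]

lemma PG.mono {f g : 𝔼 → ℝ} (hg : PG g) (hf : Continuous f) (h : ∀ z, |f z| ≤ g z) : PG f := by
  obtain ⟨_, C, hC, k, h'⟩ := hg
  exact ⟨hf, C, hC, k, fun z => (h z).trans ((le_abs_self _).trans (h' z))⟩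

lemma PG.coord (i : Fin d) : PG (fun z : 𝔼 => z i) :=
  PG.norm.mono (by fun_prop) fun z => by simpa using PiLp.norm_apply_le z i

lemma PG.congr {f g : 𝔼 → ℝ} (hf : PG f) (h : ∀ z, g z = f z) : PG g := by
  rwa [show g = f from funext h]

lemma PG.const_mul {f : 𝔼 → ℝ} (a : ℝ) (hf : PG f) : PG (fun z => a * f z) := (PG.const a).mul hf

lemma PG.sub {f g : 𝔼 → ℝ} (hf : PG f) (hg : PG g) : PG (fun z => f z - g z) :=
  (hf.add (hg.const_mul (-1))).congr fun z => by ring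

lemma PG.sum {ι : Type*} (S : Finset ι) {f : ι → 𝔼 → ℝ} (hf : ∀ i, PG (f i)) :
    PG (fun z => ∑ i ∈ S, f i z) := by
  classical
  induction S using Finset.induction_on with
  | empty => simpa using PG.const 0
  | insert a S ha ih => simpa [Finset.sum_insert ha] using (hf a).add ih

lemma PG.normsq : PG (fun z : 𝔼 => ‖z‖ ^ 2) := (PG.norm.mul PG.norm).congr fun z => by ring

lemma integrable_gauss {b : ℝ} (hb : 0 < b) :
    Integrable (fun z : 𝔼 => Real.exp (-b * ‖z‖ ^ 2)) := by
  have h := GaussianFourier.integrable_cexp_neg_mul_sq_norm_add (V := 𝔼) (b := (b : ℂ))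
    (by simpa) 0 0
  refine h.norm.congr ?_
  filter_upwards with z
  rw [Complex.norm_exp]
  congr 1
  simp [← Complex.ofReal_pow]

lemma continuous_phi : Continuous (stdGaussianDensity d) := by
  unfold stdGaussianDensity; fun_prop

lemma phi_pos (z : 𝔼) : 0 < stdGaussianDensity d z := by
  unfold stdGaussianDensity; positivity

lemma PG.integrable {f : 𝔼 → ℝ} (hf : PG f) :
    Integrable (fun z => f z * stdGaussianDensity d z) := by
  obtain ⟨hf, C, hC, k, h⟩ := hf
  have h4 : (0 : ℝ) < 1 / 4 := by norm_num
  refine ((integrable_gauss (d := d) h4).const_mul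
    (C * (4 ^ k * k.factorial * Real.exp (1 / 4)) * (2 * π) ^ (-(d : ℝ) / 2))).mono'
    (hf.mul continuous_phi).aestronglyMeasurable ?_
  filter_upwards with z
  rw [norm_mul, Real.norm_of_nonneg (phi_pos z).le]
  have h1 := Real.pow_div_factorial_le_exp (x := (1 + ‖z‖ ^ 2) / 4) (by positivity) k
  have h2 : (1 + ‖z‖ ^ 2) ^ k ≤ 4 ^ k * k.factorial * Real.exp ((1 + ‖z‖ ^ 2) / 4) := by
    rw [div_pow, div_div, div_le_iff₀ (by positivity)] at h1
    linarith
  have h3 : |f z| ≤ C * (4 ^ k * k.factorial * Real.exp ((1 + ‖z‖ ^ 2) / 4)) :=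
    (h z).trans (mul_le_mul_of_nonneg_left h2 hC)
  refine (mul_le_mul_of_nonneg_right h3 (phi_pos z).le).trans (le_of_eq ?_)
  unfold stdGaussianDensity
  have e1 : Real.exp ((1 + ‖z‖ ^ 2) / 4) = Real.exp (1 / 4) * Real.exp (‖z‖ ^ 2 / 4) := by
    rw [← Real.exp_add]; congr 1; ring
  have e2 : Real.exp (-(1 / 4) * ‖z‖ ^ 2) = Real.exp (‖z‖ ^ 2 / 4) * Real.exp (-‖z‖ ^ 2 / 2) := by
    rw [← Real.exp_add]; congr 1; ring
  rw [e1, e2]; ring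

lemma integral_phi : ∫ z : 𝔼, stdGaussianDensity d z = 1 := by
  have h2 : (0 : ℝ) < 1 / 2 := by norm_num
  have h := GaussianFourier.integral_rexp_neg_mul_sq_norm (V := 𝔼) h2
  unfold stdGaussianDensity
  rw [integral_const_mul]
  have : ∀ z : 𝔼, Real.exp (-‖z‖ ^ 2 / 2) = Real.exp (-(1 / 2) * ‖z‖ ^ 2) := fun z => by
    congr 1; ring
  simp_rw [this]
  rw [h, finrank_euclideanSpace_fin]
  rw [show π / (1 / 2) = 2 * π by ring, ← Real.rpow_add (by positivity)]
  rw [show -(d : ℝ) / 2 + d / 2 = 0 by ring, Real.rpow_zero]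

lemma hasFDerivAt_phi (z : 𝔼) : HasFDerivAt (stdGaussianDensity d)
    ((-(stdGaussianDensity d z)) • innerSL ℝ z) z := by
  have h2 := (((((hasFDerivAt_id z).norm_sq).const_mul (1 / 2 : ℝ)).neg).exp).const_mul
    ((2 * π) ^ (-(d : ℝ) / 2))
  convert! h2 using 1
  · ext y; unfold stdGaussianDensity; congr 2; simp; ring
  · ext v
    unfold stdGaussianDensity
    have : (-‖z‖ ^ 2 / 2) = -(1 / 2 * ‖z‖ ^ 2) := by ring
    rw [this]
    simp
    ring

/-- Gaussian integration by parts. -/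
lemma gauss_ibp {f f' : 𝔼 → ℝ} {Df : 𝔼 → 𝔼 →L[ℝ] ℝ} (i : Fin d) (hf : PG f) (hf' : PG f')
    (hD : ∀ z, HasFDerivAt f (Df z) z) (hDf : ∀ z, Df z (EuclideanSpace.single i 1) = f' z) :
    ∫ z, (f z * z i) * stdGaussianDensity d z = ∫ z, f' z * stdGaussianDensity d z := by
  have := integral_bilinear_hasFDerivAt_right_eq_neg_left_of_integrable
    (μ := (volume : Measure 𝔼)) (B := ContinuousLinearMap.mul ℝ ℝ) (f := f) (f' := Df)
    (g := stdGaussianDensity d) (g' := fun z => (-(stdGaussianDensity d z)) • innerSL ℝ z)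
    (v := EuclideanSpace.single i 1) ?_ ?_ ?_ (fun z _ => hD z) (fun z _ => hasFDerivAt_phi z)
  · simp only [hDf] at this
    simp [EuclideanSpace.inner_single_right, integral_neg] at this
    rw [← this]
    congr 1; ext z; ring
  · simp only [hDf]
    simpa using hf'.integrable
  · refine ((hf.mul (PG.coord i)).const_mul (-1)).integrable.congr ?_
    filter_upwards with z
    simp [EuclideanSpace.inner_single_right]
    ring
  · simpa using hf.integrable

lemma integral_normsq : ∫ z : 𝔼, ‖z‖ ^ 2 * stdGaussianDensity d z = d := by
  have h1 : ∀ i : Fin d, ∫ z : 𝔼, (z i * z i) * stdGaussianDensity d z = 1 := fun i => by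
    rw [gauss_ibp i (PG.coord i) (PG.const 1) (Df := fun _ => EuclideanSpace.proj i)
      (fun z => (EuclideanSpace.proj (𝕜 := ℝ) i).hasFDerivAt) (fun z => by simp)]
    simpa using integral_phi
  have h2 : ∀ z : 𝔼, ‖z‖ ^ 2 * stdGaussianDensity d z
      = ∑ i, (z i * z i) * stdGaussianDensity d z := fun z => by
    rw [EuclideanSpace.real_norm_sq_eq, Finset.sum_mul]
    simp_rw [pow_two]
  simp_rw [h2]
  rw [integral_finsetSum _ fun i _ => ((PG.coord i).mul (PG.coord i)).integrable]
  simp [h1]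

lemma hasDerivAt_K (s : ℝ) (z w : 𝔼) :
    HasDerivAt (fun s => K s z w) (inner ℝ (z - s • w) w * K s z w) s := by
  have h1 : HasDerivAt (fun s : ℝ => z - s • w) (-w) s := by
    simpa using ((hasDerivAt_id s).smul_const w).const_sub z
  have h2 := ((h1.norm_sq.div_const 2).neg).exp
  unfold K
  convert! h2 using 1
  simp
  ring

section
variable {ν : Measure (EuclideanSpace ℝ (Fin d))} [IsProbabilityMeasure ν]

/-- Posterior mean of the coordinates. -/
def V (ν : Measure (EuclideanSpace ℝ (Fin d))) (s : ℝ) (i : Fin d)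
    (z : EuclideanSpace ℝ (Fin d)) : ℝ := Q ν s (fun w => w i) z / P ν s z

/-- Posterior second moment of the coordinates. -/
def U (ν : Measure (EuclideanSpace ℝ (Fin d))) (s : ℝ) (i : Fin d)
    (z : EuclideanSpace ℝ (Fin d)) : ℝ := Q ν s (fun w => w i ^ 2) z / P ν s z

/-- Derivative of the normalisation in `s`. -/
def A (ν : Measure (EuclideanSpace ℝ (Fin d))) (s : ℝ)
    (z : EuclideanSpace ℝ (Fin d)) : ℝ := Q ν s (fun w => inner ℝ (z - s • w) w) z

/-- The mean log normalisation. -/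
def G (ν : Measure (EuclideanSpace ℝ (Fin d))) (s : ℝ) : ℝ :=
  ∫ z, Real.log (P ν s z) * stdGaussianDensity d z

/-- The mean squared posterior mean. -/
def N (ν : Measure (EuclideanSpace ℝ (Fin d))) (s : ℝ) : ℝ :=
  ∫ z, (∑ i, V ν s i z ^ 2) * stdGaussianDensity d z

lemma N_nonneg (ν : Measure 𝔼) (s : ℝ) : 0 ≤ N ν s :=
  integral_nonneg fun z => mul_nonneg (Finset.sum_nonneg fun i _ => sq_nonneg _) (phi_pos z).le

lemma coord_bound (i : Fin d) (w : 𝔼) : |w i| ≤ 1 + 1 * ‖w‖ ^ 2 := by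
  have : |w i| ≤ ‖w‖ := by simpa using PiLp.norm_apply_le w i
  nlinarith [sq_nonneg (‖w‖ - 1)]

lemma coord_sq_bound (i : Fin d) (w : 𝔼) : |w i ^ 2| ≤ 0 + 1 * ‖w‖ ^ 2 := by
  have : |w i| ≤ ‖w‖ := by simpa using PiLp.norm_apply_le w i
  rw [abs_pow, zero_add, one_mul]
  exact pow_le_pow_left₀ (abs_nonneg _) this 2

lemma inner_bound (s : ℝ) (z w : 𝔼) :
    |inner ℝ (z - s • w) w| ≤ ‖z‖ + (‖z‖ + |s|) * ‖w‖ ^ 2 := by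
  rw [inner_sub_left, inner_smul_left, real_inner_self_eq_norm_sq]
  have h1 := abs_sub (inner ℝ z w) (s * ‖w‖ ^ 2)
  have h2 := abs_real_inner_le_norm z w
  rw [abs_mul, abs_of_nonneg (sq_nonneg ‖w‖)] at h1
  have h3 : ‖z‖ * ‖w‖ ≤ ‖z‖ * (1 + ‖w‖ ^ 2) :=
    mul_le_mul_of_nonneg_left (by nlinarith [sq_nonneg (‖w‖ - 1)]) (norm_nonneg _)
  simp only [conj_trivial]
  linarith


lemma coord_int (hν : Integrable (fun w : 𝔼 => ‖w‖ ^ 2) ν)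
    (i : Fin d) : Integrable (fun w : 𝔼 => w i) ν :=
  of_bound hν (by fun_prop) (coord_bound i)

lemma coord_sq_int (hν : Integrable (fun w : 𝔼 => ‖w‖ ^ 2) ν)
    (i : Fin d) : Integrable (fun w : 𝔼 => w i ^ 2) ν :=
  of_bound hν (by fun_prop) (coord_sq_bound i)

lemma inner_int (hν : Integrable (fun w : 𝔼 => ‖w‖ ^ 2) ν)
    (s : ℝ) (z : 𝔼) : Integrable (fun w : 𝔼 => inner ℝ (z - s • w) w) ν :=
  of_bound hν (by fun_prop) (inner_bound s z)

lemma hasDerivAt_P (hν : Integrable (fun w : 𝔼 => ‖w‖ ^ 2) ν)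
    (s : ℝ) (z : 𝔼) : HasDerivAt (fun s => P ν s z) (A ν s z) s := by
  have := hasDerivAt_integral_of_dominated_loc_of_deriv_le (μ := ν) (𝕜 := ℝ) (s := Set.univ)
    (F := fun s w => 1 * K s z w) (x₀ := s)
    (F' := fun s w => inner ℝ (z - s • w) w * K s z w) (bound := fun w => ‖w‖)
    Filter.univ_mem
    (Filter.Eventually.of_forall fun s =>
      (integrable_mul_K s z (integrable_const 1)).aestronglyMeasurable)
    (integrable_mul_K s z (integrable_const 1))
    (integrable_mul_K s z (inner_int hν s z)).aestronglyMeasurable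
    ?_ (norm_integrable hν) ?_
  · exact this.2
  · filter_upwards with w s _
    rw [norm_mul, Real.norm_of_nonneg (K_pos s z w).le]
    have h1 := norm_mul_K_le s z w
    have h2 : ‖inner ℝ (z - s • w) w‖ ≤ ‖z - s • w‖ * ‖w‖ := norm_inner_le_norm _ _
    have h3 := mul_le_mul_of_nonneg_right h2 (K_pos s z w).le
    nlinarith [norm_nonneg w]
  · filter_upwards with w s _
    simpa using hasDerivAt_K s z w

lemma A_eq (hν : Integrable (fun w : 𝔼 => ‖w‖ ^ 2) ν)
    (s : ℝ) (z : 𝔼) :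
    A ν s z / P ν s z = ∑ i, (z i * V ν s i z - s * U ν s i z) := by
  have h : A ν s z = ∑ i, (z i * Q ν s (fun w => w i) z - s * Q ν s (fun w => w i ^ 2) z) := by
    have h1 : ∀ i : Fin d, z i * Q ν s (fun w => w i) z - s * Q ν s (fun w => w i ^ 2) z
        = Q ν s (fun w => z i * w i - s * w i ^ 2) z := fun i => by
      rw [← Q_smul, ← Q_smul, ← Q_sub s ((coord_int hν i).const_mul _)
        ((coord_sq_int hν i).const_mul _)]
    simp_rw [h1]
    unfold A Q
    rw [← integral_finsetSum _ fun i _ => integrable_mul_K s z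
      (c := fun w => z i * w i - s * w i ^ 2)
      (((coord_int hν i).const_mul _).sub ((coord_sq_int hν i).const_mul _))]
    congr 1; ext w
    rw [← Finset.sum_mul]
    congr 1
    change inner ℝ (z - s • w) w = _
    rw [PiLp.inner_apply]
    refine Finset.sum_congr rfl fun i _ => ?_
    simp
    ring
  rw [h, Finset.sum_div]
  refine Finset.sum_congr rfl fun i _ => ?_
  unfold V U
  ring

lemma PG_ratio (hν : Integrable (fun w : 𝔼 => ‖w‖ ^ 2) ν)
    {s : ℝ} (hs : s ≠ 0) {c : 𝔼 → ℝ} (hc : Continuous c) {α β : ℝ} (hβ : 0 ≤ β)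
    (h : ∀ w, |c w| ≤ α + β * ‖w‖ ^ 2) : PG (fun z => Q ν s c z / P ν s z) := by
  have : PG (fun z : 𝔼 => α + β * (6 / s ^ 2 * ‖z‖ ^ 2 + 4 * ∫ w, ‖w‖ ^ 2 ∂ν)) :=
    (PG.const α).add (((PG.normsq.const_mul (6 / s ^ 2)).add (PG.const _)).const_mul β)
  refine this.mono ((continuous_Q s (of_bound hν hc h)).div
    (continuous_Q s (integrable_const 1)) fun z => (P_pos hν s z).ne') fun z => ?_
  refine (ratio_bound hν hs z hβ h).trans (le_of_eq ?_)
  ring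

lemma PG_V (hν : Integrable (fun w : 𝔼 => ‖w‖ ^ 2) ν)
    {s : ℝ} (hs : s ≠ 0) (i : Fin d) : PG (V ν s i) :=
  PG_ratio hν hs (by fun_prop) zero_le_one (coord_bound i)

lemma PG_U (hν : Integrable (fun w : 𝔼 => ‖w‖ ^ 2) ν)
    {s : ℝ} (hs : s ≠ 0) (i : Fin d) : PG (U ν s i) :=
  PG_ratio hν hs (by fun_prop) zero_le_one (coord_sq_bound i)

lemma P_deriv_coord (hν : Integrable (fun w : 𝔼 => ‖w‖ ^ 2) ν)
    (s : ℝ) (z : 𝔼) (i : Fin d) :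
    Q ν s (fun w => 1 * (z i - s * w i)) z = z i * P ν s z - s * Q ν s (fun w => w i) z := by
  simp only [one_mul]
  rw [Q_sub s (integrable_const _) ((coord_int hν i).const_mul s), P_const, Q_smul]

lemma ibp_V (hν : Integrable (fun w : 𝔼 => ‖w‖ ^ 2) ν)
    {s : ℝ} (hs : s ≠ 0) (i : Fin d) :
    ∫ z, (z i * V ν s i z - s * U ν s i z) * stdGaussianDensity d z
      = ∫ z, (-s * V ν s i z ^ 2) * stdGaussianDensity d z := by
  have hT : PG (fun z : 𝔼 => z i * V ν s i z - s * U ν s i z) :=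
    ((PG.coord i).mul (PG_V hν hs i)).sub ((PG_U hν hs i).const_mul s)
  have hVV : PG (fun z : 𝔼 => -s * V ν s i z ^ 2) :=
    (((PG_V hν hs i).mul (PG_V hν hs i)).const_mul (-s)).congr fun z => by ring
  have hVz : PG (fun z : 𝔼 => V ν s i z * z i) := (PG_V hν hs i).mul (PG.coord i)
  have hf' : PG (fun z : 𝔼 => V ν s i z * z i + (-s * V ν s i z ^ 2)
      - (z i * V ν s i z - s * U ν s i z)) := (hVz.add hVV).sub hT
  have key := gauss_ibp i (PG_V hν hs i) hf'
    (Df := fun z => _) (fun z => (hasFDerivAt_Q s (coord_int hν i) z).mul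
      ((hasDerivAt_inv (P_pos hν s z).ne').comp_hasFDerivAt z
        (hasFDerivAt_Q s (integrable_const 1) z))) ?_
  · have e : ∀ z : 𝔼, (V ν s i z * z i + (-s * V ν s i z ^ 2)
      - (z i * V ν s i z - s * U ν s i z)) * stdGaussianDensity d z =
      (V ν s i z * z i) * stdGaussianDensity d z
        + (-s * V ν s i z ^ 2) * stdGaussianDensity d z
        - (z i * V ν s i z - s * U ν s i z) * stdGaussianDensity d z := fun z => by ring
    simp_rw [e] at key
    have hi : Integrable (fun z : 𝔼 => (V ν s i z * z i) * stdGaussianDensity d z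
        + (-s * V ν s i z ^ 2) * stdGaussianDensity d z) := hVz.integrable.add hVV.integrable
    rw [integral_sub hi hT.integrable, integral_add hVz.integrable hVV.integrable] at key
    linarith
  · intro z
    have hP := (P_pos hν s z).ne'
    have h3 : Q ν s (fun w => w i * (z i - s * w i)) z
        = z i * Q ν s (fun w => w i) z - s * Q ν s (fun w => w i ^ 2) z := by
      rw [← Q_smul, ← Q_smul, ← Q_sub s ((coord_int hν i).const_mul _)
        ((coord_sq_int hν i).const_mul _)]
      congr 1; ext w; ring
    simp only [smul_apply, add_apply, smul_eq_mul]
    rw [Q_fderiv_apply s (coord_int hν i), Q_fderiv_apply s (integrable_const 1),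
      P_deriv_coord hν, h3]
    unfold V U
    field_simp
    ring

lemma integral_A (hν : Integrable (fun w : 𝔼 => ‖w‖ ^ 2) ν)
    {s : ℝ} (hs : s ≠ 0) :
    ∫ z, (A ν s z / P ν s z) * stdGaussianDensity d z = -s * N ν s := by
  have e1 : ∀ z, (A ν s z / P ν s z) * stdGaussianDensity d z
      = ∑ i, (z i * V ν s i z - s * U ν s i z) * stdGaussianDensity d z := fun z => by
    rw [A_eq hν, Finset.sum_mul]
  have e2 : ∀ z, -s * ((∑ i, V ν s i z ^ 2) * stdGaussianDensity d z)
      = ∑ i, (-s * V ν s i z ^ 2) * stdGaussianDensity d z := fun z => by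
    rw [Finset.sum_mul, Finset.mul_sum]
    refine Finset.sum_congr rfl fun i _ => by ring
  unfold N
  rw [← integral_const_mul]
  simp_rw [e1, e2]
  rw [integral_finsetSum, integral_finsetSum]
  · exact Finset.sum_congr rfl fun i _ => ibp_V hν hs i
  · intro i _
    exact PG.integrable ((((PG_V hν hs i).mul (PG_V hν hs i)).const_mul (-s)).congr
      fun z => by ring)
  · intro i _
    exact PG.integrable (((PG.coord i).mul (PG_V hν hs i)).sub ((PG_U hν hs i).const_mul s))

lemma PG_logP (hν : Integrable (fun w : 𝔼 => ‖w‖ ^ 2) ν)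
    (s : ℝ) : PG (fun z => Real.log (P ν s z)) := by
  refine (PG.normsq.add (PG.const (s ^ 2 * ∫ w, ‖w‖ ^ 2 ∂ν))).mono ?_ (abs_log_P hν s)
  exact (continuous_Q s (integrable_const 1)).log fun z => (P_pos hν s z).ne'

lemma hasDerivAt_G (hν : Integrable (fun w : 𝔼 => ‖w‖ ^ 2) ν)
    {s : ℝ} (hs : 0 < s) : HasDerivAt (G ν) (-s * N ν s) s := by
  rw [← integral_A hν hs.ne']
  set M := ∫ w, ‖w‖ ^ 2 ∂ν with hM
  have hM0 : 0 ≤ M := integral_nonneg fun w => by positivity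
  have hPG : PG (fun z : 𝔼 => ‖z‖ + (‖z‖ + 2 * s) * (24 / s ^ 2 * ‖z‖ ^ 2 + 4 * M)) :=
    PG.norm.add ((PG.norm.add (PG.const _)).mul ((PG.normsq.const_mul _).add (PG.const _)))
  have hA : PG (fun z => A ν s z / P ν s z) := by
    refine PG.congr (PG.sum Finset.univ fun i => ?_) (A_eq hν s)
    exact ((PG.coord i).mul (PG_V hν hs.ne' i)).sub ((PG_U hν hs.ne' i).const_mul s)
  have := hasDerivAt_integral_of_dominated_loc_of_deriv_le (μ := (volume : Measure 𝔼)) (𝕜 := ℝ)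
    (s := Set.Ioo (s / 2) (2 * s))
    (F := fun s z => Real.log (P ν s z) * stdGaussianDensity d z) (x₀ := s)
    (F' := fun s z => (A ν s z / P ν s z) * stdGaussianDensity d z)
    (bound := fun z => (‖z‖ + (‖z‖ + 2 * s) * (24 / s ^ 2 * ‖z‖ ^ 2 + 4 * M))
      * stdGaussianDensity d z)
    (Ioo_mem_nhds (by linarith) (by linarith))
    (Filter.Eventually.of_forall fun s => (PG_logP hν s).integrable.aestronglyMeasurable)
    (PG_logP hν s).integrable hA.integrable.aestronglyMeasurable ?_ hPG.integrable ?_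
  · exact this.2
  · filter_upwards with z r hr
    rw [norm_mul, Real.norm_of_nonneg (phi_pos z).le]
    refine mul_le_mul_of_nonneg_right ?_ (phi_pos z).le
    have hr0 : 0 < r := by have := hr.1; linarith
    refine (ratio_bound hν hr0.ne' z (by positivity) (inner_bound r z)).trans ?_
    have h1 : 6 * ‖z‖ ^ 2 / r ^ 2 ≤ 24 / s ^ 2 * ‖z‖ ^ 2 := by
      rw [div_mul_eq_mul_div, div_le_div_iff₀ (by positivity) (by positivity)]
      have : s ^ 2 ≤ 4 * r ^ 2 := by nlinarith [hr.1]
      nlinarith [sq_nonneg ‖z‖]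
    rw [abs_of_pos hr0]
    have hr2 := hr.2
    gcongr
  · filter_upwards with z r hr
    exact ((hasDerivAt_P hν r z).log (P_pos hν r z).ne').mul_const _

lemma continuous_G (hν : Integrable (fun w : 𝔼 => ‖w‖ ^ 2) ν)
    : Continuous (G ν) := by
  rw [continuous_iff_continuousAt]
  intro s
  set M := ∫ w, ‖w‖ ^ 2 ∂ν with hM
  have hM0 : 0 ≤ M := integral_nonneg fun w => by positivity
  have hPG : PG (fun z : 𝔼 => ‖z‖ ^ 2 + (|s| + 1) ^ 2 * M) := PG.normsq.add (PG.const _)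
  refine continuousAt_of_dominated
    (bound := fun z => (‖z‖ ^ 2 + (|s| + 1) ^ 2 * M) * stdGaussianDensity d z)
    (Filter.Eventually.of_forall fun s => (PG_logP hν s).integrable.aestronglyMeasurable)
    ?_ hPG.integrable ?_
  · filter_upwards [Metric.ball_mem_nhds s one_pos] with r hr
    filter_upwards with z
    rw [norm_mul, Real.norm_of_nonneg (phi_pos z).le]
    refine mul_le_mul_of_nonneg_right ((abs_log_P hν r z).trans ?_) (phi_pos z).le
    have : |r| ≤ |s| + 1 := by
      rw [Metric.mem_ball, Real.dist_eq] at hr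
      have := abs_sub_abs_le_abs_sub r s
      linarith
    have h2 : r ^ 2 ≤ (|s| + 1) ^ 2 := by
      rw [← sq_abs r]; exact pow_le_pow_left₀ (abs_nonneg _) this 2
    gcongr
  · filter_upwards with z
    exact (((hasDerivAt_P hν s z).log (P_pos hν s z).ne').mul_const _).continuousAt

end

lemma G_zero {ν : Measure 𝔼} [IsProbabilityMeasure ν] : G ν 0 = -(d / 2) := by
  have : ∀ z : 𝔼, Real.log (P ν 0 z) * stdGaussianDensity d z
      = -(1 / 2) * (‖z‖ ^ 2 * stdGaussianDensity d z) := fun z => by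
    simp [P, Q, K]
    ring
  unfold G
  simp_rw [this]
  rw [integral_const_mul, integral_normsq]
  ring

section
variable {μ : Measure (EuclideanSpace ℝ (Fin d))} [IsProbabilityMeasure μ]

/-- The law of `X₀ - x₀`. -/
def shift (μ : Measure (EuclideanSpace ℝ (Fin d))) (x₀ : EuclideanSpace ℝ (Fin d)) :
    Measure (EuclideanSpace ℝ (Fin d)) := μ.map (fun y => y - x₀)

instance (x₀ : EuclideanSpace ℝ (Fin d)) : IsProbabilityMeasure (shift μ x₀) :=
  Measure.isProbabilityMeasure_map (by fun_prop)

lemma shift_mom (hmom : Integrable (fun x : 𝔼 => ‖x‖ ^ 2) μ) (x₀ : 𝔼) :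
    Integrable (fun w : 𝔼 => ‖w‖ ^ 2) (shift μ x₀) := by
  unfold shift
  rw [integrable_map_measure (Continuous.aestronglyMeasurable (by fun_prop)) (by fun_prop)]
  refine of_bound hmom (α := 2 * ‖x₀‖ ^ 2) (β := 2) (c := (fun w : 𝔼 => ‖w‖ ^ 2) ∘ fun y => y - x₀)
    (by fun_prop) fun y => ?_
  simp only [Function.comp_apply]
  rw [abs_of_nonneg (by positivity)]
  have h1 := norm_sub_le y x₀
  nlinarith [sq_nonneg (‖y‖ - ‖x₀‖), norm_nonneg (y - x₀)]

lemma rho_eq (x₀ : 𝔼) {t : ℝ} (ht : 0 < t) (x : 𝔼) :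
    rho d μ t x = (2 * π * t) ^ (-(d : ℝ) / 2) *
      P (shift μ x₀) (√(1 - t) / √t) ((√t)⁻¹ • (x - √(1 - t) • x₀)) := by
  have hst : 0 < √t := Real.sqrt_pos.2 ht
  unfold rho P Q shift
  rw [integral_map (by fun_prop) (by simp only [one_mul]; exact (continuous_K _ _).aestronglyMeasurable),
    ← integral_const_mul]
  congr 1; ext y
  unfold heatKernel K
  rw [one_mul]
  congr 2
  have : (√t)⁻¹ • (x - √(1 - t) • x₀) - (√(1 - t) / √t) • (y - x₀)
      = (√t)⁻¹ • (x - √(1 - t) • y) := by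
    rw [div_eq_inv_mul, mul_smul, ← smul_sub]
    congr 1
    rw [smul_sub]; abel
  rw [this, norm_smul, mul_pow, norm_inv, Real.norm_of_nonneg hst.le, inv_pow, Real.sq_sqrt ht.le]
  field_simp

lemma log_rho (hmom : Integrable (fun x : 𝔼 => ‖x‖ ^ 2) μ) (x₀ : 𝔼) {t : ℝ} (ht : 0 < t) (x : 𝔼) :
    Real.log (rho d μ t x) = -(d / 2 * Real.log (2 * π * t)) + 
      Real.log (P (shift μ x₀) (√(1 - t) / √t) ((√t)⁻¹ • (x - √(1 - t) • x₀))) := by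
  rw [rho_eq x₀ ht, Real.log_mul (by positivity) (P_pos (shift_mom hmom x₀) _ _).ne',
    Real.log_rpow (by positivity)]
  ring

lemma condExp_log_rho (hmom : Integrable (fun x : 𝔼 => ‖x‖ ^ 2) μ) (x₀ : 𝔼) {t : ℝ} (ht : 0 < t) :
    condExpX0 d t x₀ (fun x => Real.log (rho d μ t x)) =
      -(d / 2 * Real.log (2 * π * t)) + G (shift μ x₀) (√(1 - t) / √t) := by
  have hst : √t ≠ 0 := (Real.sqrt_pos.2 ht).ne'
  unfold condExpX0 G
  simp_rw [log_rho hmom x₀ ht]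
  simp only [add_sub_cancel_left, smul_smul, inv_mul_cancel₀ hst, one_smul, add_mul]
  rw [integral_add (PG.const _).integrable (PG_logP (shift_mom hmom x₀) _).integrable,
    integral_const_mul, integral_phi, mul_one]

lemma score_coord (hmom : Integrable (fun x : 𝔼 => ‖x‖ ^ 2) μ) (x₀ : 𝔼) {t : ℝ} (ht : 0 < t)
    (z : 𝔼) (i : Fin d) :
    (gradient (fun y => Real.log (rho d μ t y)) (√(1 - t) • x₀ + √t • z)) i
      = -((√t)⁻¹ * (z i - √(1 - t) / √t * V (shift μ x₀) (√(1 - t) / √t) i z)) := by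
  have hst : √t ≠ 0 := (Real.sqrt_pos.2 ht).ne'
  have hν := shift_mom hmom x₀
  have hz : (√t)⁻¹ • ((√(1 - t) • x₀ + √t • z) - √(1 - t) • x₀) = z := by
    rw [add_sub_cancel_left, smul_smul, inv_mul_cancel₀ hst, one_smul]
  have h1 : (gradient (fun y => Real.log (rho d μ t y)) (√(1 - t) • x₀ + √t • z)) i
      = fderiv ℝ (fun y => Real.log (rho d μ t y)) (√(1 - t) • x₀ + √t • z)
        (EuclideanSpace.single i 1) := by
    rw [← toDual_gradient, InnerProductSpace.toDual_apply_apply, EuclideanSpace.inner_single_right]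
    simp
  rw [h1]
  simp_rw [log_rho hmom x₀ ht]
  have hlin : HasFDerivAt (fun x : 𝔼 => (√t)⁻¹ • (x - √(1 - t) • x₀))
      ((√t)⁻¹ • ContinuousLinearMap.id ℝ 𝔼) (√(1 - t) • x₀ + √t • z) :=
    (((hasFDerivAt_id (√(1 - t) • x₀ + √t • z)).sub_const (√(1 - t) • x₀)).fun_const_smul (√t)⁻¹)
  have hP := hasFDerivAt_Q (ν := shift μ x₀) (√(1 - t) / √t) (integrable_const 1)
    ((√t)⁻¹ • ((√(1 - t) • x₀ + √t • z) - √(1 - t) • x₀))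
  have hcomp : HasFDerivAt (fun x : 𝔼 => P (shift μ x₀) (√(1 - t) / √t)
      ((√t)⁻¹ • (x - √(1 - t) • x₀))) _ (√(1 - t) • x₀ + √t • z) :=
    HasFDerivAt.comp (f := fun x : 𝔼 => (√t)⁻¹ • (x - √(1 - t) • x₀))
      (√(1 - t) • x₀ + √t • z) hP hlin
  have := ((hcomp.log (P_pos hν _ _).ne').const_add (-(d / 2 * Real.log (2 * π * t)))).fderiv
  rw [this, hz]
  simp only [smul_apply, ContinuousLinearMap.comp_apply, ContinuousLinearMap.id_apply, map_smul]
  rw [Q_fderiv_apply _ (integrable_const 1), P_deriv_coord hν]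
  have hP0 := (P_pos hν (√(1 - t) / √t) z).ne'
  change (P (shift μ x₀) (√(1 - t) / √t) z)⁻¹ • _ = _
  unfold V
  simp only [smul_eq_mul]
  field_simp

lemma scoreIntegrand_eq (hmom : Integrable (fun x : 𝔼 => ‖x‖ ^ 2) μ) (x₀ : 𝔼) {t : ℝ} (ht : 0 < t)
    (ht1 : t < 1) :
    scoreIntegrand d μ t x₀ = 1 / (2 * t ^ 2) * N (shift μ x₀) (√(1 - t) / √t) - d / (2 * t) := by
  have hst : √t ≠ 0 := (Real.sqrt_pos.2 ht).ne'
  unfold scoreIntegrand condExpX0 N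
  congr 1
  have : ∀ z : 𝔼, ‖t⁻¹ • ((√(1 - t) • x₀ + √t • z) - √(1 - t) • x₀)
      + gradient (fun y => Real.log (rho d μ t y)) (√(1 - t) • x₀ + √t • z)‖ ^ 2
        * stdGaussianDensity d z
      = (1 - t) / t ^ 2 * ((∑ i, V (shift μ x₀) (√(1 - t) / √t) i z ^ 2)
        * stdGaussianDensity d z) := fun z => by
    rw [EuclideanSpace.real_norm_sq_eq, ← mul_assoc, Finset.mul_sum]
    congr 1
    refine Finset.sum_congr rfl fun i _ => ?_
    rw [PiLp.add_apply, score_coord hmom x₀ ht, add_sub_cancel_left]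
    simp only [PiLp.smul_apply, smul_eq_mul]
    have e1 : t⁻¹ = (√t)⁻¹ * (√t)⁻¹ := by rw [← mul_inv, Real.mul_self_sqrt ht.le]
    have e2 : t⁻¹ * (√t * z i) + -((√t)⁻¹ * (z i - √(1 - t) / √t * V (shift μ x₀) (√(1 - t) / √t) i z))
      = t⁻¹ * √(1 - t) * V (shift μ x₀) (√(1 - t) / √t) i z := by
      rw [e1]; field_simp; ring
    rw [e2, mul_pow, mul_pow, Real.sq_sqrt (by linarith)]
    field_simp
  simp_rw [this]
  rw [integral_const_mul]
  have : 1 - t ≠ 0 := by linarith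
  field_simp

lemma hasDerivAt_s {t : ℝ} (ht : 0 < t) (ht1 : t < 1) : ∃ s' : ℝ,
    HasDerivAt (fun t => √(1 - t) / √t) s' t ∧ (√(1 - t) / √t) * s' = -(1 / (2 * t ^ 2)) := by
  have h1 : 0 < √t := Real.sqrt_pos.2 ht
  have h2 : 0 < √(1 - t) := Real.sqrt_pos.2 (by linarith)
  have d1 : HasDerivAt (fun t : ℝ => √(1 - t)) (-1 / (2 * √(1 - t))) t :=
    ((hasDerivAt_id t).const_sub 1).sqrt (by simp; linarith)
  have d2 : HasDerivAt (fun t : ℝ => √t) (1 / (2 * √t)) t := Real.hasDerivAt_sqrt ht.ne'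
  refine ⟨_, d1.div d2 h1.ne', ?_⟩
  obtain ⟨a, ha, ha2⟩ : ∃ a, a = √t ∧ a ^ 2 = t := ⟨_, rfl, Real.sq_sqrt ht.le⟩
  obtain ⟨b, hb, hb2⟩ : ∃ b, b = √(1 - t) ∧ b ^ 2 = 1 - t := ⟨_, rfl, Real.sq_sqrt (by linarith)⟩
  rw [← ha, ← hb]
  rw [← ha] at h1
  rw [← hb] at h2
  rw [← ha2]
  have : b ^ 2 + a ^ 2 = 1 := by rw [ha2, hb2]; ring
  field_simp
  linear_combination -this

end

end ScoreAux


open ScoreAux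
/-- **Score-based density formula (general case).** If `E[‖X₀‖²] < ∞`, then for every
`δ ∈ (0, 1)` and every `x₀`,
`E[log ρ_δ(X_δ) | X₀ = x₀] = −(1 + log(2π))·d/2 − ∫_δ¹ D(t, x₀) dt`. -/
theorem score_based_density_formula_general
    (d : ℕ) (hd : 1 ≤ d) (μ : Measure (EuclideanSpace ℝ (Fin d))) [IsProbabilityMeasure μ]
    (hmom : Integrable (fun x₀ : EuclideanSpace ℝ (Fin d) => ‖x₀‖ ^ 2) μ)
    (δ : ℝ) (hδ₀ : 0 < δ) (hδ₁ : δ < 1) (x₀ : EuclideanSpace ℝ (Fin d)) :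
    condExpX0 d δ x₀ (fun x => Real.log (rho d μ δ x))
      = -((1 + Real.log (2 * π)) / 2 * d) - ∫ t in δ..1, scoreIntegrand d μ t x₀ := by
  have hν := shift_mom hmom x₀
  set ν := shift μ x₀ with hνdef
  have hcs : ContinuousOn (fun t : ℝ => √(1 - t) / √t) (Set.Icc δ 1) := by
    refine ContinuousOn.div (by fun_prop) (by fun_prop) fun t ht => ?_
    exact (Real.sqrt_pos.2 (hδ₀.trans_le ht.1)).ne'
  have hcG : ContinuousOn (fun t : ℝ => G ν (√(1 - t) / √t)) (Set.Icc δ 1) :=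
    (continuous_G hν).comp_continuousOn hcs
  have hdG : ∀ t ∈ Set.Ioo δ 1, HasDerivAt (fun t : ℝ => G ν (√(1 - t) / √t))
      (1 / (2 * t ^ 2) * N ν (√(1 - t) / √t)) t := by
    intro t ht
    have ht0 : 0 < t := hδ₀.trans ht.1
    obtain ⟨s', h1, h2⟩ := hasDerivAt_s ht0 ht.2
    have hs : 0 < √(1 - t) / √t :=
      div_pos (Real.sqrt_pos.2 (by linarith [ht.2])) (Real.sqrt_pos.2 ht0)
    have h3 := (hasDerivAt_G hν hs).comp t h1
    convert! h3 using 1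
    linear_combination (N ν (√(1 - t) / √t)) * h2
  have hint1 : IntervalIntegrable (fun t : ℝ => 1 / (2 * t ^ 2) * N ν (√(1 - t) / √t))
      volume δ 1 := by
    rw [intervalIntegrable_iff_integrableOn_Ioc_of_le hδ₁.le]
    exact intervalIntegral.integrableOn_deriv_of_nonneg hcG hdG
      fun t _ => mul_nonneg (by positivity) (N_nonneg _ _)
  have hint2 : IntervalIntegrable (fun t : ℝ => (d : ℝ) / (2 * t)) volume δ 1 := by
    refine ContinuousOn.intervalIntegrable ?_
    rw [Set.uIcc_of_le hδ₁.le]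
    refine ContinuousOn.div (by fun_prop) (by fun_prop) fun t ht => ?_
    have := hδ₀.trans_le ht.1
    positivity
  have hlog : ∀ t, 0 < t → HasDerivAt (fun t : ℝ => -(d / 2 * Real.log (2 * π * t)))
      (-((d : ℝ) / (2 * t))) t := by
    intro t ht
    have h1 : HasDerivAt (fun t : ℝ => 2 * π * t) (2 * π) t := by
      simpa using (hasDerivAt_id t).const_mul (2 * π)
    have := ((h1.log (by positivity)).const_mul ((d : ℝ) / 2)).neg
    convert! this using 1
    field_simp
  have hftc := intervalIntegral.integral_eq_sub_of_hasDerivAt_of_le hδ₁.le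
    (f := fun t => -(d / 2 * Real.log (2 * π * t)) + G ν (√(1 - t) / √t))
    (f' := fun t => -((d : ℝ) / (2 * t)) + 1 / (2 * t ^ 2) * N ν (√(1 - t) / √t))
    (ContinuousOn.add (fun t ht => (hlog t (hδ₀.trans_le ht.1)).continuousAt.continuousWithinAt)
      hcG)
    (fun t ht => (hlog t (hδ₀.trans ht.1)).add (hdG t ht))
    (hint2.neg.add hint1)
  have heq : ∫ t in δ..1, scoreIntegrand d μ t x₀
      = ∫ t in δ..1, (-((d : ℝ) / (2 * t)) + 1 / (2 * t ^ 2) * N ν (√(1 - t) / √t)) := by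
    refine intervalIntegral.integral_congr_ae ?_
    have h1 : ∀ᵐ t : ℝ, t ≠ 1 := by simp [ae_iff]
    filter_upwards [h1] with t ht1 ht
    rw [Set.uIoc_of_le hδ₁.le] at ht
    rw [scoreIntegrand_eq hmom x₀ (hδ₀.trans ht.1) (lt_of_le_of_ne ht.2 ht1)]
    ring
  rw [heq, hftc, condExp_log_rho hmom x₀ hδ₀]
  simp only [sub_self, Real.sqrt_zero, zero_div, mul_one]
  rw [G_zero]
  ring
end
end

section
/- Suppose X₀ has a smooth density ρ₀ with sup_x ‖∇² log ρ₀(x)‖ < ∞. Then for every t ∈ (0,1) and every x ∈ ℝ^d, ∇log ρ_t(x) = (1/√(1−t)) · E[∇log ρ₀(X₀) | X_t = x], where the conditional expectation is taken with respect to the conditional law p_{X₀|X_t}(dx₀ | x) of X₀ given X_t = x. -/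
open MeasureTheory Real Filter
open scoped ENNReal

noncomputable section

lemma hk_gauss_bound {t : ℝ} (ht : 0 < t) (r : ℝ) :
    r * Real.exp (-r ^ 2 / (2 * t)) ≤ 1 + 2 * t := by
  have h1 : 1 + r ^ 2 / (2 * t) ≤ Real.exp (r ^ 2 / (2 * t)) := by
    have := Real.add_one_le_exp (r ^ 2 / (2 * t)); linarith
  have h2 : r ≤ (1 + 2 * t) * (1 + r ^ 2 / (2 * t)) := by
    have h3 : (1 + 2 * t) * (1 + r ^ 2 / (2 * t)) = 1 + 2 * t + r ^ 2 / (2 * t) + r ^ 2 := by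
      field_simp
      ring
    have : 0 ≤ r ^ 2 / (2 * t) := by positivity
    rw [h3]
    nlinarith [sq_nonneg (r - 1)]
  have h4 : r ≤ (1 + 2 * t) * Real.exp (r ^ 2 / (2 * t)) :=
    h2.trans (mul_le_mul_of_nonneg_left h1 (by positivity))
  have h5 : -r ^ 2 / (2 * t) = -(r ^ 2 / (2 * t)) := by ring
  rw [h5, Real.exp_neg, ← div_eq_mul_inv, div_le_iff₀ (Real.exp_pos _)]
  exact h4

lemma hk_pos (d : ℕ) {t : ℝ} (ht : 0 < t) (x x₀ : EuclideanSpace ℝ (Fin d)) :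
    0 < heatKernel d t x x₀ := by
  unfold heatKernel
  have := Real.pi_pos
  positivity

lemma hk_bound (d : ℕ) {t : ℝ} (ht : 0 < t) : ∃ C : ℝ, 0 ≤ C ∧
    ∀ x x₀ : EuclideanSpace ℝ (Fin d), heatKernel d t x x₀ ≤ C ∧
      heatKernel d t x x₀ * ‖x - Real.sqrt (1 - t) • x₀‖ ≤ C := by
  have hpi := Real.pi_pos
  have hc : 0 ≤ (2 * π * t) ^ (-(d : ℝ) / 2) := by positivity
  refine ⟨(2 * π * t) ^ (-(d : ℝ) / 2) * (1 + 2 * t), by positivity, fun x x₀ => ⟨?_, ?_⟩⟩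
  · unfold heatKernel
    refine mul_le_mul_of_nonneg_left ?_ hc
    have : Real.exp (-‖x - Real.sqrt (1 - t) • x₀‖ ^ 2 / (2 * t)) ≤ 1 := by
      rw [Real.exp_le_one_iff]
      exact div_nonpos_of_nonpos_of_nonneg (by simp) (by positivity)
    linarith
  · unfold heatKernel
    rw [mul_assoc, mul_comm (Real.exp _)]
    exact mul_le_mul_of_nonneg_left (hk_gauss_bound ht _) hc

lemma hk_continuous (d : ℕ) (t : ℝ) (x : EuclideanSpace ℝ (Fin d)) :
    Continuous (heatKernel d t x) := by
  unfold heatKernel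
  fun_prop

lemma hk_hasFDerivAt_aux (d : ℕ) (c t : ℝ) (w : EuclideanSpace ℝ (Fin d)) :
    HasFDerivAt (fun w : EuclideanSpace ℝ (Fin d) => c * Real.exp (-‖w‖ ^ 2 / (2 * t)))
      ((-(c * Real.exp (-‖w‖ ^ 2 / (2 * t)) / t)) • innerSL ℝ w) w := by
  have h := ((((hasStrictFDerivAt_norm_sq w).hasFDerivAt.neg).mul_const ((2 * t)⁻¹)).exp).const_mul c
  have e : (fun w : EuclideanSpace ℝ (Fin d) => c * Real.exp (-‖w‖ ^ 2 / (2 * t)))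
      = fun w => c * Real.exp (-‖w‖ ^ 2 * (2 * t)⁻¹) := by
    funext w; rw [div_eq_mul_inv]
  rw [e]
  refine h.congr_fderiv ?_
  ext v
  simp [div_eq_mul_inv]
  ring

lemma hk_hasFDerivAt_left (d : ℕ) (t : ℝ) (x x₀ : EuclideanSpace ℝ (Fin d)) :
    HasFDerivAt (fun y => heatKernel d t y x₀)
      ((-(heatKernel d t x x₀ / t)) • innerSL ℝ (x - Real.sqrt (1 - t) • x₀)) x := by
  have h := (hk_hasFDerivAt_aux d ((2 * π * t) ^ (-(d : ℝ) / 2)) t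
    (x - Real.sqrt (1 - t) • x₀)).comp x ((hasFDerivAt_id x).sub_const (Real.sqrt (1 - t) • x₀))
  exact h

lemma hk_hasFDerivAt_right (d : ℕ) (t : ℝ) (x x₀ : EuclideanSpace ℝ (Fin d)) :
    HasFDerivAt (heatKernel d t x)
      ((Real.sqrt (1 - t) * (heatKernel d t x x₀ / t)) •
        innerSL ℝ (x - Real.sqrt (1 - t) • x₀)) x₀ := by
  have h := (hk_hasFDerivAt_aux d ((2 * π * t) ^ (-(d : ℝ) / 2)) t
    (x - Real.sqrt (1 - t) • x₀)).comp x₀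
      (((hasFDerivAt_id x₀).const_smul (Real.sqrt (1 - t))).const_sub x)
  refine HasFDerivAt.congr_fderiv (f := heatKernel d t x) h ?_
  ext v
  simp [heatKernel, inner_smul_right]
  ring

lemma hk_rho_hasFDerivAt (d : ℕ) (μ : Measure (EuclideanSpace ℝ (Fin d))) [IsProbabilityMeasure μ]
    {t : ℝ} (ht : 0 < t) (x : EuclideanSpace ℝ (Fin d)) :
    Integrable (heatKernel d t x) μ ∧
    Integrable (fun x₀ => (-(heatKernel d t x x₀ / t)) •
        innerSL ℝ (x - Real.sqrt (1 - t) • x₀)) μ ∧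
    HasFDerivAt (rho d μ t) (∫ x₀, (-(heatKernel d t x x₀ / t)) •
        innerSL ℝ (x - Real.sqrt (1 - t) • x₀) ∂μ) x := by
  obtain ⟨C, hC0, hC⟩ := hk_bound d ht
  have hint : Integrable (heatKernel d t x) μ := by
    refine Integrable.mono' (integrable_const C) (hk_continuous d t x).aestronglyMeasurable ?_
    refine Eventually.of_forall fun x₀ => ?_
    rw [Real.norm_of_nonneg (hk_pos d ht x x₀).le]
    exact (hC x x₀).1
  have hcont : Continuous (fun x₀ => (-(heatKernel d t x x₀ / t)) •
        innerSL ℝ (x - Real.sqrt (1 - t) • x₀)) := by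
    have := hk_continuous d t x
    fun_prop
  have hb : ∀ x x₀ : EuclideanSpace ℝ (Fin d), ‖(-(heatKernel d t x x₀ / t)) •
        innerSL ℝ (x - Real.sqrt (1 - t) • x₀)‖ ≤ C / t := by
    intro x x₀
    rw [norm_smul, norm_neg, innerSL_apply_norm, norm_div, Real.norm_of_nonneg (hk_pos d ht x x₀).le,
      Real.norm_of_nonneg ht.le, div_mul_eq_mul_div]
    exact div_le_div_of_nonneg_right (hC x x₀).2 ht.le
  refine ⟨hint, Integrable.mono' (integrable_const (C / t)) hcont.aestronglyMeasurable
    (Eventually.of_forall (hb x)), ?_⟩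
  exact hasFDerivAt_integral_of_dominated_of_fderiv_le (s := Set.univ) (bound := fun _ => C / t)
    Filter.univ_mem
    (Eventually.of_forall fun y => (hk_continuous d t y).aestronglyMeasurable) hint
    hcont.aestronglyMeasurable
    (Eventually.of_forall fun x₀ y _ => hb y x₀) (integrable_const _)
    (Eventually.of_forall fun x₀ y _ => hk_hasFDerivAt_left d t y x₀)

/-- **Score representation.** If `X₀` has a smooth density `ρ₀` with bounded `∇² log ρ₀`,
then for every `t ∈ (0,1)` and `x ∈ ℝ^d`,
`∇log ρ_t(x) = (1/√(1−t)) · E[∇log ρ₀(X₀) | X_t = x]`, where the conditional law of `X₀` given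
`X_t = x` has density `x₀ ↦ ρ₀(x₀) · heatKernel d t x x₀ / ρ_t(x)` w.r.t. Lebesgue measure. -/
theorem score_conditional_expectation_representation
    (d : ℕ) (hd : 1 ≤ d) (μ : Measure (EuclideanSpace ℝ (Fin d))) [IsProbabilityMeasure μ]
    (ρ₀ : EuclideanSpace ℝ (Fin d) → ℝ)
    (hdensity : μ = volume.withDensity (fun x => ENNReal.ofReal (ρ₀ x)))
    (hpos : ∀ x, 0 < ρ₀ x) (hsmooth : ContDiff ℝ (⊤ : ℕ∞) ρ₀)
    (hhess : ∃ L : ℝ, ∀ x, ‖fderiv ℝ (gradient (fun y => Real.log (ρ₀ y))) x‖ ≤ L)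
    (t : ℝ) (ht₀ : 0 < t) (ht₁ : t < 1) (x : EuclideanSpace ℝ (Fin d)) :
    gradient (fun y => Real.log (rho d μ t y)) x
      = (1 / Real.sqrt (1 - t)) •
          ∫ x₀, (ρ₀ x₀ * heatKernel d t x x₀ / rho d μ t x) •
            gradient (fun y => Real.log (ρ₀ y)) x₀ := by
  classical
  obtain ⟨L, hL⟩ := hhess
  set a := Real.sqrt (1 - t) with ha
  have ha0 : 0 < a := Real.sqrt_pos.2 (by linarith)
  set g := gradient (fun y => Real.log (ρ₀ y)) with hg
  have hρd : Differentiable ℝ ρ₀ := hsmooth.differentiable (by simp)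
  have hlog : ContDiff ℝ (⊤ : ℕ∞) (fun y => Real.log (ρ₀ y)) :=
    hsmooth.log (fun y => (hpos y).ne')
  have hgC : ContDiff ℝ 1 g := by
    have h1 : ContDiff ℝ 1 (fderiv ℝ (fun y => Real.log (ρ₀ y))) :=
      hlog.fderiv_right (by norm_cast)
    exact (InnerProductSpace.toDual ℝ (EuclideanSpace ℝ (Fin d))).symm.contDiff.comp h1
  have hgcont : Continuous g := hgC.continuous
  have hglip : ∀ y, ‖g y‖ ≤ ‖g 0‖ + |L| * ‖y‖ := by
    intro y
    have h := Convex.norm_image_sub_le_of_norm_fderiv_le (𝕜 := ℝ) (f := g) (s := Set.univ)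
      (x := 0) (y := y)
      (fun z _ => hgC.differentiable (by simp) z) (fun z _ => (hL z).trans (le_abs_self L))
      convex_univ (Set.mem_univ _) (Set.mem_univ _)
    rw [sub_zero] at h
    have := norm_le_norm_add_norm_sub' (g y) (g 0)
    linarith
  have hfd : ∀ y v, fderiv ℝ ρ₀ y v = ρ₀ y * inner ℝ (g y) v := by
    intro y v
    rw [hg, inner_gradient_left, fderiv.log (hρd y) (hpos y).ne']
    have := (hpos y).ne'
    simp
    field_simp
  obtain ⟨C, hC0, hC⟩ := hk_bound d ht₀
  obtain ⟨hkint, hk'int, hrho⟩ := hk_rho_hasFDerivAt d μ ht₀ x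
  have hmeas : Measurable (fun x => ENNReal.ofReal (ρ₀ x)) :=
    hρd.continuous.measurable.ennreal_ofReal
  have hρint : Integrable ρ₀ := by
    have h1 : Integrable (fun _ : EuclideanSpace ℝ (Fin d) => (1 : ℝ)) μ := integrable_const _
    rw [hdensity, integrable_withDensity_iff_integrable_smul' hmeas
      (Eventually.of_forall fun _ => ENNReal.ofReal_lt_top)] at h1
    refine h1.congr (Eventually.of_forall fun y => ?_)
    simp [ENNReal.toReal_ofReal (hpos y).le]
  have hμ : ∀ f : EuclideanSpace ℝ (Fin d) → ℝ, ∫ y, f y ∂μ = ∫ y, ρ₀ y * f y := by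
    intro f
    rw [hdensity, integral_withDensity_eq_integral_toReal_smul hmeas
      (Eventually.of_forall fun _ => ENNReal.ofReal_lt_top)]
    refine integral_congr_ae (Eventually.of_forall fun y => ?_)
    simp [ENNReal.toReal_ofReal (hpos y).le]
  have hρt : 0 < rho d μ t x := by
    unfold rho
    rw [integral_pos_iff_support_of_nonneg (fun y => (hk_pos d ht₀ x y).le) hkint]
    have : Function.support (fun y => heatKernel d t x y) = Set.univ := by
      ext y; simp [(hk_pos d ht₀ x y).ne']
    rw [this]
    simp
  have hnorm : ∀ y, ‖y‖ ≤ (‖x‖ + ‖x - a • y‖) / a := by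
    intro y
    rw [le_div_iff₀ ha0]
    have h1 : ‖a • y‖ = a * ‖y‖ := by rw [norm_smul, Real.norm_of_nonneg ha0.le]
    have h2 := norm_le_norm_add_norm_sub' (a • y) x
    rw [norm_sub_rev] at h2
    linarith
  have hkcont := hk_continuous d t x
  have hρcont := hρd.continuous
  -- main integrability
  set D := C * ‖g 0‖ + |L| * ((C * ‖x‖ + C) / a) with hD
  have hkg : ∀ y, heatKernel d t x y * ‖g y‖ ≤ D := by
    intro y
    have hk0 := (hk_pos d ht₀ x y).le
    obtain ⟨hC1, hC2⟩ := hC x y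
    have h1 : heatKernel d t x y * ‖y‖ ≤ (C * ‖x‖ + C) / a := by
      calc heatKernel d t x y * ‖y‖
          ≤ heatKernel d t x y * ((‖x‖ + ‖x - a • y‖) / a) :=
            mul_le_mul_of_nonneg_left (hnorm y) hk0
        _ = (heatKernel d t x y * ‖x‖ + heatKernel d t x y * ‖x - a • y‖) / a := by ring
        _ ≤ _ := by gcongr
    calc heatKernel d t x y * ‖g y‖
        ≤ heatKernel d t x y * (‖g 0‖ + |L| * ‖y‖) := mul_le_mul_of_nonneg_left (hglip y) hk0
      _ = heatKernel d t x y * ‖g 0‖ + |L| * (heatKernel d t x y * ‖y‖) := by ring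
      _ ≤ _ := by rw [hD]; gcongr
  have hG : Integrable (fun y => (ρ₀ y * heatKernel d t x y) • g y) := by
    refine Integrable.mono' (hρint.const_mul D) (by fun_prop) ?_
    refine Eventually.of_forall fun y => ?_
    rw [norm_smul, norm_mul, Real.norm_of_nonneg (hpos y).le,
      Real.norm_of_nonneg (hk_pos d ht₀ x y).le]
    have := mul_le_mul_of_nonneg_left (hkg y) (hpos y).le
    linarith
  -- integration by parts
  have hkd : ∀ y v, fderiv ℝ (heatKernel d t x) y v
      = a * (heatKernel d t x y / t) * inner ℝ (x - a • y) v := by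
    intro y v
    rw [(hk_hasFDerivAt_right d t x y).fderiv]
    rw [smul_apply, innerSL_apply_apply, smul_eq_mul]
  have hibp : ∀ v, ∫ y, heatKernel d t x y * fderiv ℝ ρ₀ y v
      = - ∫ y, fderiv ℝ (heatKernel d t x) y v * ρ₀ y := by
    intro v
    apply integral_mul_fderiv_eq_neg_fderiv_mul_of_integrable
    · simp_rw [hkd]
      refine Integrable.mono' (hρint.const_mul (a / t * C * ‖v‖)) (by fun_prop) ?_
      refine Eventually.of_forall fun y => ?_
      have hk0 := hk_pos d ht₀ x y
      rw [norm_mul, norm_mul, Real.norm_of_nonneg (hpos y).le,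
        Real.norm_of_nonneg (by positivity : 0 ≤ a * (heatKernel d t x y / t))]
      refine mul_le_mul_of_nonneg_right ?_ (hpos y).le
      calc a * (heatKernel d t x y / t) * ‖inner ℝ (x - a • y) v‖
          ≤ a * (heatKernel d t x y / t) * (‖x - a • y‖ * ‖v‖) := by
            gcongr; exact norm_inner_le_norm _ _
        _ = a / t * (heatKernel d t x y * ‖x - a • y‖) * ‖v‖ := by ring
        _ ≤ _ := by gcongr; exact (hC x y).2
    · refine (hG.inner_const v).congr (Eventually.of_forall fun y => ?_)
      simp only [hfd, real_inner_smul_left]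
      ring
    · refine Integrable.mono' (hρint.const_mul C) (by fun_prop) ?_
      refine Eventually.of_forall fun y => ?_
      rw [norm_mul, Real.norm_of_nonneg (hpos y).le, Real.norm_of_nonneg (hk_pos d ht₀ x y).le]
      exact mul_le_mul_of_nonneg_right (hC x y).1 (hpos y).le
    · exact fun y _ => (hk_hasFDerivAt_right d t x y).differentiableAt
    · exact fun y _ => hρd y
  refine ext_inner_right ℝ fun v => ?_
  rw [inner_gradient_left, fderiv.log hrho.differentiableAt hρt.ne', hrho.fderiv,
    smul_apply, ContinuousLinearMap.integral_apply hk'int, hμ,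
    real_inner_smul_left]
  have e1 : ∫ y, (ρ₀ y * heatKernel d t x y / rho d μ t x) • g y
      = (rho d μ t x)⁻¹ • ∫ y, (ρ₀ y * heatKernel d t x y) • g y := by
    rw [← integral_smul]
    refine integral_congr_ae (Eventually.of_forall fun y => ?_)
    simp only [smul_smul]
    congr 1
    ring
  have e2 : inner ℝ (∫ y, (ρ₀ y * heatKernel d t x y) • g y) v
      = ∫ y, heatKernel d t x y * fderiv ℝ ρ₀ y v := by
    rw [real_inner_comm, ← integral_inner hG]
    refine integral_congr_ae (Eventually.of_forall fun y => ?_)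
    simp only [hfd, real_inner_smul_right, real_inner_comm v]
    ring
  rw [e1, real_inner_smul_left, e2, hibp, ← integral_neg, smul_eq_mul, mul_left_comm]
  congr 1
  rw [← integral_const_mul]
  refine integral_congr_ae (Eventually.of_forall fun y => ?_)
  simp only [hkd, smul_apply, innerSL_apply_apply, smul_eq_mul, ← ha]
  field_simp
end
end
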